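/- arXiv:1712.08562 — 3 statements merged into one kernel-verified Lean document; each statement's English description precedes it below -/
import Mathlib

section
/- Let ν be a real-valued valuation (v : K* → ℝ, so ν has rank at most 1) of a field K which dominates a Noetherian local domain R with quotient field K, and let R̂ be the m_R-adic completion of R. Define P(R̂)_∞ := {h ∈ R̂ : there exists a sequence (f_n) in R converging m_R-adically to h with ν(f_n) → +∞}. Then P(R̂)_∞ is an ideal of R̂, and its contraction to R is the zero ideal: P(R̂)_∞ ∩ R = (0). In particular the natural map R → R̂/P(R̂)_∞ is injective. -/
noncomputable section

/-- `v` is (the additive form of) a real-valued valuation on the field `K`. -/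
def IsRealValuation {K : Type*} [Field K] (v : K → ℝ) : Prop :=
  (∀ a b : K, a ≠ 0 → b ≠ 0 → v (a * b) = v a + v b) ∧
  (∀ a b : K, a ≠ 0 → b ≠ 0 → a + b ≠ 0 → min (v a) (v b) ≤ v (a + b))

/-- The valuation `v` on the quotient field of `R` dominates the local domain `R`:
`R ⊆ V_v` and `m_v ∩ R = m_R`. -/
def DominatesLocal (R : Type*) [CommRing R] [IsDomain R] [IsLocalRing R]
    (v : FractionRing R → ℝ) : Prop :=
  (∀ r : R, r ≠ 0 → 0 ≤ v (algebraMap R (FractionRing R) r)) ∧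
  (∀ r : R, r ≠ 0 →
    (0 < v (algebraMap R (FractionRing R) r) ↔ r ∈ IsLocalRing.maximalIdeal R))

/-- The sequence `f` in `R` converges `m_R`-adically to `h` in the completion `R̂`. -/
def ConvTo (R : Type*) [CommRing R] [IsLocalRing R] (f : ℕ → R)
    (h : AdicCompletion (IsLocalRing.maximalIdeal R) R) : Prop :=
  ∀ m : ℕ, ∃ N : ℕ, ∀ n ≥ N,
    algebraMap R (AdicCompletion (IsLocalRing.maximalIdeal R) R) (f n) - h ∈
      (IsLocalRing.maximalIdeal R ^ m).map
        (algebraMap R (AdicCompletion (IsLocalRing.maximalIdeal R) R))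

/-- `v (f n) → +∞`, with the convention `v 0 = +∞`. -/
def ValTendstoTop (R : Type*) [CommRing R] [IsDomain R]
    (v : FractionRing R → ℝ) (f : ℕ → R) : Prop :=
  ∀ B : ℝ, ∃ N : ℕ, ∀ n ≥ N, f n = 0 ∨ B < v (algebraMap R (FractionRing R) (f n))

/-- The prime ideal `P(R̂)_∞` of elements of the completion of value `∞`. -/
def PInf (R : Type*) [CommRing R] [IsDomain R] [IsLocalRing R]
    (v : FractionRing R → ℝ) : Set (AdicCompletion (IsLocalRing.maximalIdeal R) R) :=
  {h | ∃ f : ℕ → R, ConvTo R f h ∧ ValTendstoTop R v f}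

namespace AdicCompletion

variable {R : Type*} [CommRing R] {I : Ideal R}

theorem mem_map_pow_iff_evalₐ_eq_zero (hI : I.FG) {n : ℕ} {x : AdicCompletion I R} :
    x ∈ (I ^ n).map (algebraMap R (AdicCompletion I R)) ↔ evalₐ I n x = 0 := by
  have h : I ^ n • ⊤ ≤ I ^ n := by simp
  have h' : I ^ n ≤ I ^ n • ⊤ := by simp
  have hker := pow_smul_top_eq_ker_eval (M := R) (n := n) hI
  rw [Ideal.smul_top_eq_map] at hker
  have hmem : x ∈ (I ^ n).map (algebraMap R (AdicCompletion I R)) ↔ eval I R n x = 0 := by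
    rw [← LinearMap.mem_ker, ← hker, Submodule.restrictScalars_mem]
  rw [hmem]
  constructor
  · intro hx
    rw [← factor_eval_eq_evalₐ I x h, hx]
    exact _root_.map_zero (Ideal.Quotient.factor h)
  · intro hx
    rw [← factor_evalₐ_eq_eval I x h', hx]
    exact _root_.map_zero (Ideal.Quotient.factor h')

theorem algebraMap_mem_map_pow_iff (hI : I.FG) {n : ℕ} {r : R} :
    algebraMap R (AdicCompletion I R) r ∈ (I ^ n).map (algebraMap R (AdicCompletion I R)) ↔
      r ∈ I ^ n := by
  rw [mem_map_pow_iff_evalₐ_eq_zero hI, AlgHom.commutes, Ideal.Quotient.algebraMap_eq,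
    Ideal.Quotient.eq_zero_iff_mem]

theorem exists_algebraMap_sub_mem_map_pow (hI : I.FG) (x : AdicCompletion I R) (n : ℕ) :
    ∃ r : R, algebraMap R (AdicCompletion I R) r - x ∈
      (I ^ n).map (algebraMap R (AdicCompletion I R)) := by
  obtain ⟨r, hr⟩ := Ideal.Quotient.mk_surjective (evalₐ I n x)
  refine ⟨r, ?_⟩
  rw [mem_map_pow_iff_evalₐ_eq_zero hI, map_sub, AlgHom.commutes, ← hr,
    Ideal.Quotient.algebraMap_eq, sub_self]

end AdicCompletion

section ConvTo

variable {R : Type*} [CommRing R] [IsLocalRing R]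
  {f g : ℕ → R} {h k : AdicCompletion (IsLocalRing.maximalIdeal R) R}

theorem ConvTo.add (hf : ConvTo R f h) (hg : ConvTo R g k) :
    ConvTo R (fun n => f n + g n) (h + k) := by
  intro m
  obtain ⟨N, hN⟩ := hf m
  obtain ⟨M, hM⟩ := hg m
  refine ⟨max N M, fun n hn => ?_⟩
  rw [map_add, add_sub_add_comm]
  exact add_mem (hN n (le_of_max_le_left hn)) (hM n (le_of_max_le_right hn))

theorem ConvTo.mul (hf : ConvTo R f h) (hg : ConvTo R g k) :
    ConvTo R (fun n => f n * g n) (h * k) := by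
  intro m
  obtain ⟨N, hN⟩ := hf m
  obtain ⟨M, hM⟩ := hg m
  refine ⟨max N M, fun n hn => ?_⟩
  rw [map_mul, ← sub_add_sub_cancel _ (algebraMap R _ (f n) * k), ← mul_sub, ← sub_mul]
  exact add_mem (Ideal.mul_mem_left _ _ (hM n (le_of_max_le_right hn)))
    (Ideal.mul_mem_right _ _ (hN n (le_of_max_le_left hn)))

theorem ConvTo.zero : ConvTo R (fun _ => 0) 0 := fun m => ⟨0, fun n _ => by simp⟩

theorem exists_convTo [IsNoetherianRing R]
    (h : AdicCompletion (IsLocalRing.maximalIdeal R) R) : ∃ f : ℕ → R, ConvTo R f h := by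
  choose f hf using AdicCompletion.exists_algebraMap_sub_mem_map_pow
    (IsLocalRing.maximalIdeal R).fg_of_isNoetherianRing h
  exact ⟨f, fun m => ⟨m, fun n hn => Ideal.map_mono (Ideal.pow_le_pow_right hn) (hf n)⟩⟩

end ConvTo

section Valuation

variable {R : Type*} [CommRing R] [IsDomain R] {v : FractionRing R → ℝ}

/-- The ideal of elements of `R` of value at least `b`. -/
def valueIdeal (hv : IsRealValuation v)
    (hpos : ∀ r : R, r ≠ 0 → 0 ≤ v (algebraMap R (FractionRing R) r)) (b : ℝ) : Ideal R where
  carrier := {r | r = 0 ∨ b ≤ v (algebraMap R (FractionRing R) r)}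
  zero_mem' := Or.inl rfl
  add_mem' := by
    rintro x y hx hy
    by_cases hx0 : x = 0
    · simpa [hx0] using hy
    by_cases hy0 : y = 0
    · simpa [hy0] using hx
    by_cases hxy : x + y = 0
    · exact Or.inl hxy
    refine Or.inr ((le_min (hx.resolve_left hx0) (hy.resolve_left hy0)).trans ?_)
    rw [map_add]
    refine hv.2 _ _ (by simpa using hx0) (by simpa using hy0) ?_
    rw [← map_add]
    exact (map_ne_zero_iff _ (IsFractionRing.injective R (FractionRing R))).2 hxy
  smul_mem' := by
    rintro c x hx
    by_cases hx0 : x = 0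
    · exact Or.inl (by simp [hx0])
    by_cases hc0 : c = 0
    · exact Or.inl (by simp [hc0])
    refine Or.inr ?_
    rw [smul_eq_mul, map_mul, hv.1 _ _ (by simpa using hc0) (by simpa using hx0)]
    exact le_add_of_nonneg_of_le (hpos c hc0) (hx.resolve_left hx0)

variable (hv : IsRealValuation v)
  (hpos : ∀ r : R, r ≠ 0 → 0 ≤ v (algebraMap R (FractionRing R) r))

theorem valueIdeal_mul_le (a b : ℝ) :
    valueIdeal hv hpos a * valueIdeal hv hpos b ≤ valueIdeal hv hpos (a + b) := by
  refine Ideal.mul_le.2 fun x hx y hy => ?_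
  by_cases hx0 : x = 0
  · exact Or.inl (by simp [hx0])
  by_cases hy0 : y = 0
  · exact Or.inl (by simp [hy0])
  refine Or.inr ?_
  rw [map_mul, hv.1 _ _ (by simpa using hx0) (by simpa using hy0)]
  exact add_le_add (hx.resolve_left hx0) (hy.resolve_left hy0)

theorem valueIdeal_zero : valueIdeal hv hpos 0 = ⊤ :=
  eq_top_iff.2 fun r _ => or_iff_not_imp_left.2 (hpos r)

theorem valueIdeal_pow_le (a : ℝ) (n : ℕ) :
    valueIdeal hv hpos a ^ n ≤ valueIdeal hv hpos (n * a) := by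
  induction n with
  | zero => simp [valueIdeal_zero]
  | succ n ih =>
    rw [pow_succ, Nat.cast_succ, add_one_mul]
    exact (Ideal.mul_mono_left ih).trans (valueIdeal_mul_le hv hpos _ _)

theorem exists_pos_le_valueIdeal {J : Ideal R} (hJ : J.FG)
    (hJpos : ∀ r ∈ J, r ≠ 0 → 0 < v (algebraMap R (FractionRing R) r)) :
    ∃ c : ℝ, 0 < c ∧ J ≤ valueIdeal hv hpos c := by
  obtain ⟨s, rfl⟩ := hJ
  have hs : ∀ r ∈ s, ∃ c : ℝ, 0 < c ∧ r ∈ valueIdeal hv hpos c := by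
    intro r hr
    by_cases hr0 : r = 0
    · exact ⟨1, one_pos, Or.inl hr0⟩
    · exact ⟨_, hJpos r (Ideal.subset_span hr) hr0, Or.inr le_rfl⟩
  choose! c hc hmem using hs
  obtain ⟨d, hd, hle⟩ : ∃ d : ℝ, 0 < d ∧ ∀ r ∈ s, d ≤ c r := by
    rcases s.eq_empty_or_nonempty with rfl | hne
    · exact ⟨1, one_pos, by simp⟩
    · obtain ⟨r, hr, hmin⟩ := s.exists_min_image c hne
      exact ⟨c r, hc r hr, hmin⟩
  exact ⟨d, hd, Ideal.span_le.2 fun r hr => (hmem r hr).imp_right (hle r hr).trans⟩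

theorem valTendstoTop_iff {f : ℕ → R} :
    ValTendstoTop R v f ↔ ∀ b : ℝ, ∃ N : ℕ, ∀ n ≥ N, f n ∈ valueIdeal hv hpos b := by
  constructor <;> intro hf b
  · obtain ⟨N, hN⟩ := hf b
    exact ⟨N, fun n hn => (hN n hn).imp_right le_of_lt⟩
  · obtain ⟨N, hN⟩ := hf (b + 1)
    exact ⟨N, fun n hn => (hN n hn).imp_right (lt_add_one b).trans_le⟩

end Valuation

section PInf

variable {R : Type*} [CommRing R] [IsDomain R] [IsLocalRing R] [IsNoetherianRing R]
  {v : FractionRing R → ℝ}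

/-- The set `PInf R v` as an ideal of the completion. -/
def pInfIdeal (hv : IsRealValuation v) (hdom : DominatesLocal R v) :
    Ideal (AdicCompletion (IsLocalRing.maximalIdeal R) R) where
  carrier := PInf R v
  zero_mem' := ⟨fun _ => 0, ConvTo.zero, fun _ => ⟨0, fun _ _ => Or.inl rfl⟩⟩
  add_mem' := by
    rintro h k ⟨f, hf, hfv⟩ ⟨g, hg, hgv⟩
    refine ⟨_, hf.add hg, (valTendstoTop_iff hv hdom.1).2 fun b => ?_⟩
    obtain ⟨N, hN⟩ := (valTendstoTop_iff hv hdom.1).1 hfv b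
    obtain ⟨M, hM⟩ := (valTendstoTop_iff hv hdom.1).1 hgv b
    exact ⟨max N M, fun n hn =>
      add_mem (hN n (le_of_max_le_left hn)) (hM n (le_of_max_le_right hn))⟩
  smul_mem' := by
    rintro c h ⟨f, hf, hfv⟩
    obtain ⟨g, hg⟩ := exists_convTo c
    refine ⟨_, hg.mul hf, (valTendstoTop_iff hv hdom.1).2 fun b => ?_⟩
    obtain ⟨N, hN⟩ := (valTendstoTop_iff hv hdom.1).1 hfv b
    exact ⟨N, fun n hn => Ideal.mul_mem_left _ _ (hN n hn)⟩

theorem eq_zero_of_algebraMap_mem_pInf (hv : IsRealValuation v) (hdom : DominatesLocal R v)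
    {r : R} (hr : algebraMap R (AdicCompletion (IsLocalRing.maximalIdeal R) R) r ∈ PInf R v) :
    r = 0 := by
  by_contra hr0
  obtain ⟨f, hf, hfv⟩ := hr
  have hfg := (IsLocalRing.maximalIdeal R).fg_of_isNoetherianRing
  obtain ⟨c, hc, hle⟩ := exists_pos_le_valueIdeal hv hdom.1 hfg
    fun x hx hx0 => (hdom.2 x hx0).2 hx
  set b := v (algebraMap R (FractionRing R) r) + 1 with hb
  obtain ⟨m, hm⟩ := exists_nat_ge (b / c)
  obtain ⟨N, hN⟩ := hf m
  obtain ⟨M, hM⟩ := (valTendstoTop_iff hv hdom.1).1 hfv b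
  have hdiff := hN (max N M) (le_max_left _ _)
  rw [← map_sub, AdicCompletion.algebraMap_mem_map_pow_iff hfg] at hdiff
  have hdiff' : f (max N M) - r ∈ valueIdeal hv hdom.1 b :=
    (valueIdeal_pow_le hv hdom.1 c m (Ideal.pow_right_mono hle m hdiff)).imp_right
      ((div_le_iff₀ hc).1 hm).trans
  have hmem : r ∈ valueIdeal hv hdom.1 b := by
    simpa using sub_mem (hM (max N M) (le_max_right _ _)) hdiff'
  have := hmem.resolve_left hr0
  linarith

end PInf

theorem extensions_of_valuations_statement5 (R : Type*) [CommRing R] [IsDomain R]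
    [IsLocalRing R] [IsNoetherianRing R]
    (v : FractionRing R → ℝ) (hv : IsRealValuation v) (hdom : DominatesLocal R v) :
    (∃ I : Ideal (AdicCompletion (IsLocalRing.maximalIdeal R) R),
      (I : Set (AdicCompletion (IsLocalRing.maximalIdeal R) R)) = PInf R v) ∧
    (∀ r : R, algebraMap R (AdicCompletion (IsLocalRing.maximalIdeal R) R) r ∈ PInf R v →
      r = 0) := by
  exact ⟨⟨pInfIdeal hv hdom, rfl⟩, fun _ => eq_zero_of_algebraMap_mem_pInf hv hdom⟩
end
end

section
/- Let k be an algebraically closed field and let p_1, p_2, p_3, … be pairwise distinct prime numbers, each different from the characteristic of k. Let κ be an algebraic closure of the rational function field k(t), and for each i ≥ 1 let α_i ∈ κ be a root of the polynomial u^{p_i} − (1+t). Then for every i ≥ 1, the polynomial u^{p_i} − (1+t) is the minimal polynomial of α_i over k(t)(α_1, …, α_{i−1}); in particular it is irreducible over k(t)(α_1, …, α_{i−1}) and [k(t)(α_1, …, α_i) : k(t)(α_1, …, α_{i−1})] = p_i. -/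
noncomputable section

open Polynomial IntermediateField

theorem ratFunc_pow_ne_one_add_X {k : Type*} [Field k] {n : ℕ} (hn : n ≠ 1) (b : RatFunc k) :
    b ^ n ≠ 1 + RatFunc.X := by
  intro h
  have hX : (1 + RatFunc.X : RatFunc k) = algebraMap k[X] (RatFunc k) (X + C 1) := by
    simp [add_comm]
  have hdeg : (1 + RatFunc.X : RatFunc k).intDegree = 1 := by
    rw [hX, RatFunc.intDegree_polynomial, natDegree_X_add_C]
    rfl
  have hne : (1 + RatFunc.X : RatFunc k) ≠ 0 := by
    intro h0
    simp [h0] at hdeg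
  have hpow : ∀ (c : RatFunc k) (m : ℕ), c ≠ 0 → (c ^ m).intDegree = m * c.intDegree := by
    intro c m hc
    induction m with
    | zero => simp
    | succ m ih =>
      rw [pow_succ, RatFunc.intDegree_mul (pow_ne_zero _ hc) hc, ih]
      push_cast
      ring
  by_cases hb : b = 0
  · rcases Nat.eq_zero_or_pos n with rfl | hn0
    · simp only [pow_zero] at h
      simp [← h] at hdeg
    · exact hne (by rw [← h, hb, zero_pow hn0.ne'])
  · have h1 := hpow b n hb
    rw [h, hdeg] at h1
    have : (n : ℤ) ∣ 1 := ⟨_, h1⟩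
    exact hn (by exact_mod_cast Int.eq_one_of_dvd_one (by positivity) this)

section Radical

variable {K L : Type*} [Field K] [Field L] [Algebra K L]

/-- A radical polynomial of prime degree stays irreducible in extensions of degree prime to it. -/
theorem irreducible_X_pow_sub_C_algebraMap_of_not_dvd_finrank {p : ℕ} (hp : p.Prime) {a : K}
    (ha : ∀ b : K, b ^ p ≠ a) [FiniteDimensional K L] (h : ¬ p ∣ Module.finrank K L) :
    Irreducible (X ^ p - C (algebraMap K L a)) := by
  refine X_pow_sub_C_irreducible_of_prime hp fun b hb => h ?_
  have hmin : X ^ p - C a = minpoly K b :=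
    minpoly.eq_of_irreducible_of_monic (X_pow_sub_C_irreducible_of_prime hp ha)
      (by simp [hb]) (monic_X_pow_sub_C a hp.ne_zero)
  have := minpoly.degree_dvd (K := K) (Algebra.IsIntegral.isIntegral b)
  rwa [← hmin, natDegree_X_pow_sub_C] at this

theorem minpoly_eq_X_pow_sub_C_of_irreducible {n : ℕ} (hn : n ≠ 0) {a : K} {x : L}
    (hx : x ^ n = algebraMap K L a) (h : Irreducible (X ^ n - C a)) :
    minpoly K x = X ^ n - C a :=
  (minpoly.eq_of_irreducible_of_monic h (by simp [hx]) (monic_X_pow_sub_C a hn)).symm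

theorem finrank_adjoin_simple_of_irreducible_X_pow_sub_C {n : ℕ} (hn : n ≠ 0) {a : K} {x : L}
    (hx : x ^ n = algebraMap K L a) (h : Irreducible (X ^ n - C a)) :
    Module.finrank K K⟮x⟯ = n := by
  have hint : IsIntegral K x := ⟨_, monic_X_pow_sub_C a hn, by simp [hx]⟩
  rw [adjoin.finrank hint, minpoly_eq_X_pow_sub_C_of_irreducible hn hx h, natDegree_X_pow_sub_C]

variable {p : ℕ → ℕ} {a : K} {α : ℕ → L}

theorem finiteDimensional_adjoin_radicals (hp : ∀ i, (p i).Prime)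
    (hα : ∀ i, α i ^ p i = algebraMap K L a) (i : ℕ) :
    FiniteDimensional K (adjoin K (α '' {j | j < i})) := by
  have : Finite (α '' {j | j < i}) := ((Set.finite_lt_nat i).image α).to_subtype
  refine finiteDimensional_adjoin ?_
  rintro _ ⟨j, -, rfl⟩
  exact ⟨_, monic_X_pow_sub_C a (hp j).ne_zero, by simp [hα j]⟩

theorem not_dvd_prod_range_of_injective (hp : ∀ i, (p i).Prime) (hinj : Function.Injective p)
    (i : ℕ) : ¬ p i ∣ ∏ j ∈ Finset.range i, p j := by
  rw [(hp i).prime.dvd_finsetProd_iff]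
  rintro ⟨j, hj, hdvd⟩
  have := hinj ((Nat.prime_dvd_prime_iff_eq (hp i) (hp j)).1 hdvd)
  simp [this] at hj

theorem finrank_adjoin_radicals (hp : ∀ i, (p i).Prime) (hinj : Function.Injective p)
    (ha : ∀ i, ∀ b : K, b ^ p i ≠ a) (hα : ∀ i, α i ^ p i = algebraMap K L a) (i : ℕ) :
    Module.finrank K (adjoin K (α '' {j | j < i})) = ∏ j ∈ Finset.range i, p j := by
  induction i with
  | zero => simp
  | succ i ih =>
    have := finiteDimensional_adjoin_radicals hp hα i
    have hirr := irreducible_X_pow_sub_C_algebraMap_of_not_dvd_finrank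
      (L := adjoin K (α '' {j | j < i})) (hp i) (ha i)
      (ih ▸ not_dvd_prod_range_of_injective hp hinj i)
    have hset : α '' {j | j < i + 1} = α '' {j | j < i} ∪ {α i} := by
      rw [← Set.image_singleton, ← Set.image_union]
      congr 1
      ext j
      simp [le_iff_eq_or_lt]
    have hfin := finrank_adjoin_simple_of_irreducible_X_pow_sub_C
      (K := adjoin K (α '' {j | j < i})) (hp i).ne_zero (hα i) hirr
    rw [hset, ← adjoin_adjoin_left, Finset.prod_range_succ, ← ih]
    exact (Module.finrank_mul_finrank K (adjoin K (α '' {j | j < i}))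
      (adjoin (adjoin K (α '' {j | j < i})) {α i})).symm.trans (by rw [hfin])

theorem irreducible_X_pow_sub_C_adjoin_radicals (hp : ∀ i, (p i).Prime)
    (hinj : Function.Injective p) (ha : ∀ i, ∀ b : K, b ^ p i ≠ a)
    (hα : ∀ i, α i ^ p i = algebraMap K L a) (i : ℕ) :
    Irreducible (X ^ p i - C (algebraMap K (adjoin K (α '' {j | j < i})) a)) := by
  have := finiteDimensional_adjoin_radicals hp hα i
  refine irreducible_X_pow_sub_C_algebraMap_of_not_dvd_finrank (hp i) (ha i) ?_
  rw [finrank_adjoin_radicals hp hinj ha hα]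
  exact not_dvd_prod_range_of_injective hp hinj i

end Radical

set_option synthInstance.maxHeartbeats 1000000 in
set_option maxHeartbeats 2000000 in
theorem extensions_of_valuations_statement6 (k : Type*) [Field k] [IsAlgClosed k]
    (p : ℕ → ℕ) (hp : ∀ i, (p i).Prime) (hinj : Function.Injective p)
    (hchar : ∀ i, ringChar k ≠ p i)
    (α : ℕ → AlgebraicClosure (RatFunc k))
    (hα : ∀ i, (α i) ^ (p i) =
      algebraMap (RatFunc k) (AlgebraicClosure (RatFunc k)) (1 + RatFunc.X)) :
    ∀ i : ℕ,
      minpoly (IntermediateField.adjoin (RatFunc k) (α '' {j | j < i})) (α i) =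
        Polynomial.X ^ (p i) - Polynomial.C (algebraMap (RatFunc k)
          (IntermediateField.adjoin (RatFunc k) (α '' {j | j < i})) (1 + RatFunc.X)) ∧
      Irreducible (Polynomial.X ^ (p i) - Polynomial.C (algebraMap (RatFunc k)
          (IntermediateField.adjoin (RatFunc k) (α '' {j | j < i})) (1 + RatFunc.X))) ∧
      Module.finrank (IntermediateField.adjoin (RatFunc k) (α '' {j | j < i}))
        (IntermediateField.adjoin
          (IntermediateField.adjoin (RatFunc k) (α '' {j | j < i})) {α i}) = p i := by
  intro i
  have hirr := irreducible_X_pow_sub_C_adjoin_radicals hp hinj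
    (fun i => ratFunc_pow_ne_one_add_X (hp i).ne_one) hα i
  exact ⟨minpoly_eq_X_pow_sub_C_of_irreducible (hp i).ne_zero (hα i) hirr, hirr,
    finrank_adjoin_simple_of_irreducible_X_pow_sub_C (hp i).ne_zero (hα i) hirr⟩
end
end

section
/- Let A be a Noetherian integrally closed (normal) local domain with quotient field K. Let p be a prime number such that p·1_A is a unit of A, and let u be a unit of A such that the polynomial X^p − u is irreducible over K. Let L = K[X]/(X^p − u), let λ ∈ L be the class of X, and let B = A[λ] be the subring of L generated by A and λ. Then: (1) B is the integral closure of A in L (in particular B is a normal ring); (2) B is unramified over A, i.e., the module of Kähler differentials Ω_{B/A} vanishes; and (3) if moreover A is a regular local ring, then for every prime ideal q of B lying over m_A the localization B_q is a regular local ring whose maximal ideal is generated by m_A. -/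
noncomputable section

open Polynomial

/-- A regular local ring: a Noetherian local ring whose maximal ideal (= the set of
nonunits) can be generated by `Krull dimension`-many elements. -/
def IsRegularLocal (R : Type*) [CommRing R] : Prop :=
  IsNoetherianRing R ∧ IsLocalRing R ∧
    ∃ s : Finset R, ((Ideal.span (s : Set R) : Ideal R) : Set R) = {x : R | ¬IsUnit x} ∧
      (s.card : WithBot (WithTop ℕ)) = ringKrullDim R

variable (A : Type*) [CommRing A] [IsDomain A]

/-- The field `L = K[X]/(X^p - u)`, where `K` is the quotient field of `A`. -/
abbrev Lfield (p : ℕ) (u : A) : Type _ :=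
  AdjoinRoot (X ^ p - C (algebraMap A (FractionRing A) u))

noncomputable instance (p : ℕ) (u : A) : Algebra A (Lfield A p u) :=
  ((algebraMap (FractionRing A) (Lfield A p u)).comp
    (algebraMap A (FractionRing A))).toAlgebra

/-- The subring `B = A[λ]` of `L` generated by `A` and the class `λ` of `X`. -/
abbrev Bsub (p : ℕ) (u : A) : Subalgebra A (Lfield A p u) :=
  Algebra.adjoin A {AdjoinRoot.root (X ^ p - C (algebraMap A (FractionRing A) u))}

noncomputable instance (p : ℕ) (u : A) (q : Ideal (Bsub A p u)) [q.IsPrime] :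
    Algebra A (Localization.AtPrime q) :=
  ((algebraMap (Bsub A p u) (Localization.AtPrime q)).comp
    (algebraMap A (Bsub A p u))).toAlgebra

/-- An algebra generated by a root of a polynomial whose derivative takes a unit value at that
root is formally unramified. -/
lemma formallyUnramified_of_adjoin_eq_top_of_isUnit_derivative {R S : Type*} [CommRing R]
    [CommRing S] [Algebra R S] {x : S} (hx : Algebra.adjoin R {x} = ⊤) {f : R[X]}
    (hf : aeval x f = 0) (hf' : IsUnit (aeval x (derivative f))) :
    Algebra.FormallyUnramified R S := by
  have hDx : KaehlerDifferential.D R S x = 0 := by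
    have h := (KaehlerDifferential.D R S).map_aeval f x
    rw [hf, map_zero] at h
    exact (hf'.smul_eq_zero).1 h.symm
  have hD (y : S) : KaehlerDifferential.D R S y = 0 := by
    have hy : y ∈ Algebra.adjoin R {x} := hx ▸ Algebra.mem_top
    exact Derivation.eqOn_adjoin (D1 := KaehlerDifferential.D R S) (D2 := 0)
      (by simpa [Set.EqOn] using hDx) hy
  refine ⟨?_⟩
  rw [← Submodule.subsingleton_iff S, ← subsingleton_iff_bot_eq_top,
    ← KaehlerDifferential.span_range_derivation, eq_comm, Submodule.span_eq_bot]
  rintro _ ⟨y, rfl⟩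
  exact hD y

/-- If the value at the integral generator of a power basis of the derivative of its minimal
polynomial has an integral inverse, then the generator generates the integral closure. -/
lemma adjoin_eq_integralClosure_of_isIntegral_inv {R K L : Type*} [CommRing R] [IsDomain R]
    [IsIntegrallyClosed R] [Field K] [Field L] [Algebra R K] [IsFractionRing R K] [Algebra K L]
    [Algebra R L] [IsScalarTower R K L] [Algebra.IsSeparable K L]
    (B : PowerBasis K L) (hint : IsIntegral R B.gen)
    (hinv : IsIntegral R (aeval B.gen (derivative (minpoly K B.gen)))⁻¹) :
    Algebra.adjoin R {B.gen} = integralClosure R L := by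
  have := B.finite
  refine le_antisymm (Algebra.adjoin_le (by simpa [mem_integralClosure_iff] using hint)) ?_
  intro z hz
  have hz' : IsIntegral R z := hz
  have hdisc := Algebra.discr_mul_isIntegral_mem_adjoin K hint hz'
  set g := aeval B.gen (derivative (minpoly K B.gen))
  have hg : g ≠ 0 := (Algebra.IsSeparable.isSeparable K B.gen).aeval_derivative_ne_zero
    (minpoly.aeval K B.gen)
  obtain ⟨c, hc⟩ := IsIntegrallyClosed.isIntegral_iff.1 (Algebra.isIntegral_norm K hinv)
  rw [Algebra.discr_powerBasis_eq_norm] at hdisc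
  set n := Module.finrank K L * (Module.finrank K L - 1) / 2
  have key : ((-1) ^ n * c : R) • (((-1) ^ n * Algebra.norm K g : K) • z) = z := by
    rw [← algebraMap_smul K, smul_smul, map_mul, hc, map_pow, map_neg, map_one, mul_mul_mul_comm,
      ← mul_pow, ← map_mul, inv_mul_cancel₀ hg]
    simp
  rw [← key]
  exact Subalgebra.smul_mem _ hdisc _

/-- A finite unramified extension of a normal local domain by a domain preserves the maximal
ideal and regularity. -/
lemma isRegularLocal_localization_of_formallyUnramified {R S : Type*} [CommRing R] [CommRing S]
    [IsDomain S] [Algebra R S] [FaithfulSMul R S] [IsLocalRing R] [IsNoetherianRing R]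
    [IsIntegrallyClosed R] [Module.Finite R S] [Algebra.FormallyUnramified R S]
    (q : Ideal S) [q.IsPrime] [q.LiesOver (IsLocalRing.maximalIdeal R)] :
    IsLocalRing.maximalIdeal (Localization.AtPrime q) =
        (IsLocalRing.maximalIdeal R).map (algebraMap R (Localization.AtPrime q)) ∧
      (IsRegularLocal R → IsRegularLocal (Localization.AtPrime q)) := by
  classical
  have hS : IsNoetherianRing S := IsNoetherianRing.of_finite R S
  have hq : IsNoetherianRing (Localization.AtPrime q) :=
    IsLocalization.isNoetherianRing q.primeCompl _ hS
  have : Algebra.FormallyUnramified S (Localization.AtPrime q) :=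
    .of_isLocalization q.primeCompl
  have : Algebra.FormallyUnramified R (Localization.AtPrime q) := .comp R S _
  have : Algebra.EssFiniteType S (Localization.AtPrime q) := .of_isLocalization _ q.primeCompl
  have : Algebra.EssFiniteType R (Localization.AtPrime q) := .comp R S _
  have hcomap : (IsLocalRing.maximalIdeal (Localization.AtPrime q)).comap
      (algebraMap R (Localization.AtPrime q)) = IsLocalRing.maximalIdeal R := by
    rw [IsScalarTower.algebraMap_eq R S (Localization.AtPrime q), ← Ideal.comap_comap]
    change Ideal.comap _ (Ideal.under S _) = _
    rw [Localization.AtPrime.under_maximalIdeal]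
    exact (Ideal.over_def q (IsLocalRing.maximalIdeal R)).symm
  have : IsLocalHom (algebraMap R (Localization.AtPrime q)) :=
    ((IsLocalRing.local_hom_TFAE _).out 0 4).2 hcomap
  have hmax := Algebra.FormallyUnramified.map_maximalIdeal (R := R)
    (S := Localization.AtPrime q)
  refine ⟨hmax.symm, fun ⟨_, _, s, hs, hcard⟩ ↦ ⟨hq, inferInstance,
    s.image (algebraMap R (Localization.AtPrime q)), ?_, ?_⟩⟩
  all_goals
    have hs' : Ideal.span (s : Set R) = IsLocalRing.maximalIdeal R :=
      SetLike.coe_injective (by rw [hs]; rfl)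
    have himage : Ideal.span (s.image (algebraMap R (Localization.AtPrime q)) :
        Set (Localization.AtPrime q)) = IsLocalRing.maximalIdeal _ := by
      rw [Finset.coe_image, ← Ideal.map_span, hs', hmax]
  · rw [himage]
    rfl
  · have hle : ringKrullDim R ≤ ringKrullDim (Localization.AtPrime q) := by
      rw [IsLocalization.AtPrime.ringKrullDim_eq_height q (Localization.AtPrime q),
        ← IsLocalRing.maximalIdeal_height_eq_ringKrullDim,
        Ideal.height_eq_height_add_of_liesOver_of_hasGoingDown (IsLocalRing.maximalIdeal R) q]
      exact_mod_cast le_self_add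
    refine le_antisymm (le_trans ?_ (hcard.trans_le hle))
      ((ringKrullDim_le_spanFinrank_maximalIdeal _).trans ?_)
    · exact_mod_cast Finset.card_image_le
    · rw [← himage]
      refine le_trans (Nat.cast_le.2 (Submodule.spanFinrank_span_le_ncard_of_finite
        (Finset.finite_toSet _))) ?_
      rw [Set.ncard_coe_finset]
      rfl

/-- The derivative of `X ^ n - u` takes a unit value at every root when `n` and `u` are units. -/
lemma isUnit_aeval_derivative_X_pow_sub_C {R S : Type*} [CommRing R] [CommRing S] [Algebra R S]
    {n : ℕ} (hn : IsUnit (n : R)) (hn0 : n ≠ 0) {u : R} (hu : IsUnit u) {x : S}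
    (hx : x ^ n = algebraMap R S u) : IsUnit (aeval x (derivative (X ^ n - C u))) := by
  have hxu : IsUnit x := (isUnit_pow_iff hn0).1 (hx ▸ hu.map _)
  have h := (hn.map (algebraMap R S)).mul (hxu.pow (n - 1))
  rw [map_natCast] at h
  simpa only [derivative_sub, derivative_X_pow, derivative_C, sub_zero, map_mul, map_natCast,
    map_pow, aeval_X] using h

/-- Adjoining an `n`-th root of a unit is unramified when `n` is invertible. -/
lemma formallyUnramified_adjoin_of_pow_eq {R S : Type*} [CommRing R] [CommRing S] [Algebra R S]
    {n : ℕ} (hn : IsUnit (n : R)) (hn0 : n ≠ 0) {u : R} (hu : IsUnit u) {r : S}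
    (hr : r ^ n = algebraMap R S u) :
    Algebra.FormallyUnramified R (Algebra.adjoin R {r}) := by
  let x : Algebra.adjoin R {r} := ⟨r, Algebra.subset_adjoin rfl⟩
  have hx : x ^ n = algebraMap R (Algebra.adjoin R {r}) u := Subtype.ext hr
  have hadjoin : Algebra.adjoin R {x} = ⊤ := by
    rw [← Algebra.adjoin_adjoin_coe_preimage]
    congr 1
    ext y
    simp [x, Subtype.ext_iff]
  exact formallyUnramified_of_adjoin_eq_top_of_isUnit_derivative hadjoin
    (f := X ^ n - C u) (by simp [hx]) (isUnit_aeval_derivative_X_pow_sub_C hn hn0 hu hx)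

/-- If `n` and `u` are units of the normal domain `R` and `X ^ n - u` is the minimal polynomial of
the generator of a power basis of `L` over the quotient field `K`, then this generator
generates the integral closure of `R` in `L`. -/
lemma adjoin_eq_integralClosure_of_minpoly_eq_X_pow_sub_C {R K L : Type*} [CommRing R]
    [IsDomain R] [IsIntegrallyClosed R] [Field K] [Field L] [Algebra R K] [IsFractionRing R K]
    [Algebra K L] [Algebra R L] [IsScalarTower R K L] {n : ℕ} (hn : IsUnit (n : R)) (hn0 : n ≠ 0)
    {u : R} (hu : IsUnit u) (B : PowerBasis K L)
    (hB : minpoly K B.gen = X ^ n - C (algebraMap R K u)) :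
    Algebra.adjoin R {B.gen} = integralClosure R L := by
  have hroot : aeval B.gen (X ^ n - C (algebraMap R K u)) = 0 := hB ▸ minpoly.aeval K B.gen
  have hpowK : B.gen ^ n = algebraMap K L (algebraMap R K u) := by
    simpa [sub_eq_zero] using hroot
  have hpow : B.gen ^ n = algebraMap R L u := by rw [hpowK, ← IsScalarTower.algebraMap_apply]
  have hint {v : R} (hv : IsUnit v) : IsIntegral R (algebraMap R L v)⁻¹ := by
    obtain ⟨v, rfl⟩ := hv
    rw [← map_units_inv]
    exact isIntegral_algebraMap
  have hnK : IsUnit (n : K) := by simpa using hn.map (algebraMap R K)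
  have : Algebra.FormallyUnramified K L :=
    formallyUnramified_of_adjoin_eq_top_of_isUnit_derivative B.adjoin_gen_eq_top hroot
      (isUnit_aeval_derivative_X_pow_sub_C hnK hn0 (hu.map _) hpowK)
  have := B.finite
  have : Algebra.IsSeparable K L := Algebra.FormallyUnramified.isSeparable _ _
  have hinv : IsIntegral R B.gen⁻¹ :=
    .of_pow (Nat.pos_of_ne_zero hn0) (by rw [inv_pow, hpow]; exact hint hu)
  refine adjoin_eq_integralClosure_of_isIntegral_inv B
    (.of_pow (Nat.pos_of_ne_zero hn0) (hpow ▸ isIntegral_algebraMap)) ?_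
  have hderiv : aeval B.gen (derivative (minpoly K B.gen)) =
      algebraMap R L n * B.gen ^ (n - 1) := by
    simp only [hB, derivative_sub, derivative_X_pow, derivative_C, sub_zero, map_mul, map_natCast,
      map_pow, aeval_X]
  rw [hderiv, mul_inv, ← inv_pow]
  exact (hint hn).mul (hinv.pow _)

theorem extensions_of_valuations_statement8 [IsLocalRing A] [IsNoetherianRing A]
    [IsIntegrallyClosed A]
    (p : ℕ) (hp : p.Prime) (hpu : IsUnit (p : A)) (u : A) (hu : IsUnit u)
    (hirr : Irreducible (X ^ p - C (algebraMap A (FractionRing A) u))) :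
    (Bsub A p u = integralClosure A (Lfield A p u)) ∧
    Subsingleton (Ω[(Bsub A p u)⁄A]) ∧
    (IsRegularLocal A →
      ∀ (q : Ideal (Bsub A p u)) [q.IsPrime],
        q.comap (algebraMap A (Bsub A p u)) = IsLocalRing.maximalIdeal A →
        IsRegularLocal (Localization.AtPrime q) ∧
        IsLocalRing.maximalIdeal (Localization.AtPrime q) =
          (IsLocalRing.maximalIdeal A).map (algebraMap A (Localization.AtPrime q))) := by
  have : Fact (Irreducible (X ^ p - C (algebraMap A (FractionRing A) u))) := ⟨hirr⟩
  have htower := @IsScalarTower.of_algebraMap_eq A (FractionRing A) (Lfield A p u)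
    _ _ _ _ _ _ fun _ ↦ rfl
  have hmonic : (X ^ p - C (algebraMap A (FractionRing A) u)).Monic :=
    monic_X_pow_sub_C _ hp.ne_zero
  have hpow : AdjoinRoot.root (X ^ p - C (algebraMap A (FractionRing A) u)) ^ p =
      algebraMap A (Lfield A p u) u := by
    have h := AdjoinRoot.eval₂_root (X ^ p - C (algebraMap A (FractionRing A) u))
    rw [eval₂_sub, eval₂_pow, eval₂_X, eval₂_C, sub_eq_zero] at h
    exact h
  have hint : IsIntegral A (AdjoinRoot.root (X ^ p - C (algebraMap A (FractionRing A) u))) :=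
    .of_pow hp.pos (hpow ▸ isIntegral_algebraMap)
  have hfinite : Module.Finite A (Bsub A p u) := .of_fg hint.fg_adjoin_singleton
  have hunramified : Algebra.FormallyUnramified A (Bsub A p u) :=
    formallyUnramified_adjoin_of_pow_eq hpu hp.ne_zero hu hpow
  refine ⟨?_, hunramified.subsingleton_kaehlerDifferential, fun hreg q _ hq ↦ ?_⟩
  · exact @adjoin_eq_integralClosure_of_minpoly_eq_X_pow_sub_C A (FractionRing A) (Lfield A p u)
      _ _ _ _ _ _ _ _ _ htower _ hpu hp.ne_zero _ hu (AdjoinRoot.powerBasis hmonic.ne_zero)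
      (AdjoinRoot.minpoly_powerBasis_gen_of_monic hmonic)
  · have hinj : Function.Injective (algebraMap A (Bsub A p u)) := by
      refine .of_comp (f := algebraMap (Bsub A p u) (Lfield A p u)) ?_
      exact (algebraMap (FractionRing A) (Lfield A p u)).injective.comp
        (IsFractionRing.injective A (FractionRing A))
    have hfaithful := (faithfulSMul_iff_algebraMap_injective A (Bsub A p u)).2 hinj
    have : q.LiesOver (IsLocalRing.maximalIdeal A) := ⟨hq.symm⟩
    obtain ⟨hmax, hreg'⟩ := isRegularLocal_localization_of_formallyUnramified (R := A) q
    exact ⟨hreg' hreg, hmax⟩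
end
end
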